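/- arXiv:1608.03394 — 6 statements merged into one kernel-verified Lean document; each statement's English description precedes it below -/
import Mathlib

section
/- If β is real, τ > 0, and Δ(iβ,τ) = 0, then (δ + Kγ)² + (ω0 + Kq0 − β)² = (K²/4)((1+γ)² + q0²). In particular, if (δ + Kγ)² − (K²/4)((1+γ)² + q0²) > 0 (condition (P1)), then Δ(·,τ) has no purely imaginary root for any τ > 0; and if (δ + Kγ)² − (K²/4)((1+γ)² + q0²) ≤ 0, then β = ω0 + Kq0 + √((K²/4)((1+γ)² + q0²) − (δ + Kγ)²) or β = ω0 + Kq0 − √((K²/4)((1+γ)² + q0²) − (δ + Kγ)²). -/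
/-- The characteristic function Δ(λ,τ) of the linearization of the
Ott–Antonsen reduced delayed Kuramoto model with distributed shear. -/
noncomputable def charEq (K δ γ ω0 q0 : ℝ) (lam : ℂ) (τ : ℝ) : ℂ :=
  lam + ((δ + K * γ : ℝ) : ℂ)
    - ((K / 2 * (1 + γ) : ℝ) : ℂ) * Complex.exp (-lam * (τ : ℂ))
    - Complex.I * ((ω0 + K * q0 : ℝ) : ℂ)
    + Complex.I * ((K * q0 / 2 : ℝ) : ℂ) * Complex.exp (-lam * (τ : ℂ))
theorem charEq_root_aux (K δ γ ω0 q0 β τ : ℝ)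
    (h : charEq K δ γ ω0 q0 (Complex.I * (β : ℂ)) τ = 0) :
    (δ + K * γ) ^ 2 + (ω0 + K * q0 - β) ^ 2 = K ^ 2 / 4 * ((1 + γ) ^ 2 + q0 ^ 2) := by
  have he : Complex.exp (-(Complex.I * (β : ℂ)) * (τ : ℂ))
      = ((Real.cos (β * τ) : ℝ) : ℂ) - ((Real.sin (β * τ) : ℝ) : ℂ) * Complex.I := by
    have : -(Complex.I * (β : ℂ)) * (τ : ℂ) = ((-(β * τ) : ℝ) : ℂ) * Complex.I := by
      push_cast; ring
    rw [this, Complex.exp_mul_I, ← Complex.ofReal_cos, ← Complex.ofReal_sin,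
      Real.cos_neg, Real.sin_neg]
    push_cast; ring
  unfold charEq at h
  rw [he] at h
  have hcs := Real.sin_sq_add_cos_sq (β * τ)
  generalize Real.cos (β * τ) = c at *
  generalize Real.sin (β * τ) = s at *
  have hre := congrArg Complex.re h
  have him := congrArg Complex.im h
  simp only [Complex.add_re, Complex.sub_re, Complex.mul_re, Complex.I_re, Complex.I_im,
    Complex.ofReal_re, Complex.ofReal_im, Complex.add_im, Complex.sub_im, Complex.mul_im,
    Complex.zero_re, Complex.zero_im] at hre him
  have h1 : δ + K * γ = K / 2 * (1 + γ) * c - K * q0 / 2 * s := by linarith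
  have h2 : ω0 + K * q0 - β = K / 2 * (1 + γ) * s + K * q0 / 2 * c := by linarith
  rw [h1, h2]
  linear_combination (K ^ 2 / 4 * ((1 + γ) ^ 2 + q0 ^ 2)) * hcs

/-- Any purely imaginary root iβ of the characteristic equation (τ > 0)
satisfies (δ+Kγ)² + (ω0+Kq0−β)² = (K²/4)((1+γ)²+q0²).  Under (P1) there are
no purely imaginary roots; otherwise β must equal β₊ or β₋. -/
theorem stmt2 (K δ γ ω0 q0 : ℝ) (hK : 0 < K) (hδ : 0 < δ) (hγ : 0 ≤ γ) :
    (∀ β τ : ℝ, 0 < τ → charEq K δ γ ω0 q0 (Complex.I * (β : ℂ)) τ = 0 →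
      (δ + K * γ) ^ 2 + (ω0 + K * q0 - β) ^ 2
        = K ^ 2 / 4 * ((1 + γ) ^ 2 + q0 ^ 2)) ∧
    ((δ + K * γ) ^ 2 - K ^ 2 / 4 * ((1 + γ) ^ 2 + q0 ^ 2) > 0 →
      ∀ β τ : ℝ, 0 < τ → charEq K δ γ ω0 q0 (Complex.I * (β : ℂ)) τ ≠ 0) ∧
    ((δ + K * γ) ^ 2 - K ^ 2 / 4 * ((1 + γ) ^ 2 + q0 ^ 2) ≤ 0 →
      ∀ β τ : ℝ, 0 < τ → charEq K δ γ ω0 q0 (Complex.I * (β : ℂ)) τ = 0 →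
        β = ω0 + K * q0
            + Real.sqrt (K ^ 2 / 4 * ((1 + γ) ^ 2 + q0 ^ 2) - (δ + K * γ) ^ 2) ∨
        β = ω0 + K * q0
            - Real.sqrt (K ^ 2 / 4 * ((1 + γ) ^ 2 + q0 ^ 2) - (δ + K * γ) ^ 2)) := by
  refine ⟨fun β τ _ h => charEq_root_aux K δ γ ω0 q0 β τ h, ?_, ?_⟩
  · intro hP β τ _ h
    have := charEq_root_aux K δ γ ω0 q0 β τ h
    nlinarith [sq_nonneg (ω0 + K * q0 - β)]
  · intro _ β τ _ h
    have h0 := charEq_root_aux K δ γ ω0 q0 β τ h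
    have h1 : K ^ 2 / 4 * ((1 + γ) ^ 2 + q0 ^ 2) - (δ + K * γ) ^ 2
        = (β - (ω0 + K * q0)) ^ 2 := by linarith
    rw [h1, Real.sqrt_sq_eq_abs]
    rcases abs_choice (β - (ω0 + K * q0)) with h2 | h2
    · left; rw [h2]; ring
    · right; rw [h2]; ring
end

section
/- Let β be real, τ̄ ≥ 0, and suppose Δ(iβ, τ̄) = 0. Denote by Δ_λ and Δ_τ the partial derivatives of Δ with respect to λ and τ evaluated at (iβ, τ̄). Then Δ_λ ≠ 0 and the real part of −Δ_τ/Δ_λ (the derivative of the root with respect to τ given by implicit differentiation) equals β(β − ω0 − Kq0) / ( (1 + τ̄(δ + Kγ))² + τ̄²(β − ω0 − Kq0)² ). -/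
/-- β₊ = ω0 + Kq0 + √((K²/4)((1+γ)²+q0²) − (δ+Kγ)²). -/
noncomputable def betaP (K δ γ ω0 q0 : ℝ) : ℝ :=
  ω0 + K * q0 + Real.sqrt (K ^ 2 / 4 * ((1 + γ) ^ 2 + q0 ^ 2) - (δ + K * γ) ^ 2)

/-- β₋ = ω0 + Kq0 − √((K²/4)((1+γ)²+q0²) − (δ+Kγ)²). -/
noncomputable def betaM (K δ γ ω0 q0 : ℝ) : ℝ :=
  ω0 + K * q0 - Real.sqrt (K ^ 2 / 4 * ((1 + γ) ^ 2 + q0 ^ 2) - (δ + K * γ) ^ 2)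
/-- Transversality computation: at a purely imaginary root iβ with delay τ̄,
the λ-partial derivative of Δ is nonzero and the real part of −Δ_τ/Δ_λ equals
β(β−ω0−Kq0) / ((1+τ̄(δ+Kγ))² + τ̄²(β−ω0−Kq0)²). -/
theorem stmt4 (K δ γ ω0 q0 : ℝ) (hK : 0 < K) (hδ : 0 < δ) (hγ : 0 ≤ γ)
    (β τbar : ℝ) (hτ : 0 ≤ τbar)
    (hroot : charEq K δ γ ω0 q0 (Complex.I * (β : ℂ)) τbar = 0) :
    deriv (fun lam : ℂ => charEq K δ γ ω0 q0 lam τbar) (Complex.I * (β : ℂ)) ≠ 0 ∧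
    (-(deriv (fun t : ℝ => charEq K δ γ ω0 q0 (Complex.I * (β : ℂ)) t) τbar) /
        deriv (fun lam : ℂ => charEq K δ γ ω0 q0 lam τbar) (Complex.I * (β : ℂ))).re
      = β * (β - ω0 - K * q0) /
          ((1 + τbar * (δ + K * γ)) ^ 2 + τbar ^ 2 * (β - ω0 - K * q0) ^ 2) := by
  have hlin : ∀ x : ℂ, HasDerivAt (fun lam : ℂ => Complex.exp (-lam * (τbar : ℂ)))
      (Complex.exp (-x * (τbar : ℂ)) * (-1 * (τbar : ℂ))) x := by
    intro x
    exact (((hasDerivAt_id x).neg).mul_const (τbar : ℂ)).cexp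
  have htau : HasDerivAt (fun t : ℝ => Complex.exp (-(Complex.I * (β : ℂ)) * (t : ℂ)))
      (Complex.exp (-(Complex.I * (β : ℂ)) * (τbar : ℂ)) * (-(Complex.I * (β : ℂ)) * 1)) τbar := by
    exact ((Complex.ofRealCLM.hasDerivAt (x := τbar)).const_mul (-(Complex.I * (β : ℂ)))).cexp
  have h1 := ((((hasDerivAt_id (Complex.I * (β : ℂ))).add_const
    (((δ + K * γ : ℝ) : ℂ))).sub ((hlin (Complex.I * (β : ℂ))).const_mul
    (((K / 2 * (1 + γ) : ℝ) : ℂ)))).sub_const (Complex.I * ((ω0 + K * q0 : ℝ) : ℂ))).add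
    ((hlin (Complex.I * (β : ℂ))).const_mul (Complex.I * ((K * q0 / 2 : ℝ) : ℂ)))
  have h2 := (((htau.const_mul (((K / 2 * (1 + γ) : ℝ) : ℂ))).const_sub
    (Complex.I * (β : ℂ) + ((δ + K * γ : ℝ) : ℂ))).sub_const
    (Complex.I * ((ω0 + K * q0 : ℝ) : ℂ))).add
    (htau.const_mul (Complex.I * ((K * q0 / 2 : ℝ) : ℂ)))
  have e1 : deriv (fun lam : ℂ => charEq K δ γ ω0 q0 lam τbar) (Complex.I * (β : ℂ)) = _ :=
    HasDerivAt.deriv h1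
  have e2 : deriv (fun t : ℝ => charEq K δ γ ω0 q0 (Complex.I * (β : ℂ)) t) τbar = _ :=
    HasDerivAt.deriv h2
  unfold charEq at hroot
  set E := Complex.exp (-(Complex.I * (β : ℂ)) * (τbar : ℂ)) with hE
  have f1 : deriv (fun lam : ℂ => charEq K δ γ ω0 q0 lam τbar) (Complex.I * (β : ℂ))
      = ⟨1 + τbar * (δ + K * γ), τbar * (β - ω0 - K * q0)⟩ := by
    rw [e1, Complex.mk_eq_add_mul_I]
    push_cast at hroot ⊢
    linear_combination (-(τbar : ℂ)) * hroot
  have f2 : deriv (fun t : ℝ => charEq K δ γ ω0 q0 (Complex.I * (β : ℂ)) t) τbar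
      = ⟨-(β * (β - ω0 - K * q0)), β * (δ + K * γ)⟩ := by
    rw [e2, Complex.mk_eq_add_mul_I]
    push_cast at hroot ⊢
    linear_combination (-(Complex.I * (β : ℂ))) * hroot
      + (β : ℂ) * (β - ω0 - K * q0) * Complex.I_sq
  have hpos : 0 < 1 + τbar * (δ + K * γ) := by positivity
  rw [f1, f2]
  refine ⟨fun h => hpos.ne' (congrArg Complex.re h), ?_⟩
  have hD : 0 < (1 + τbar * (δ + K * γ)) ^ 2 + τbar ^ 2 * (β - ω0 - K * q0) ^ 2 := by positivity
  have hN : Complex.normSq ⟨1 + τbar * (δ + K * γ), τbar * (β - ω0 - K * q0)⟩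
      = (1 + τbar * (δ + K * γ)) ^ 2 + τbar ^ 2 * (β - ω0 - K * q0) ^ 2 := by
    rw [Complex.normSq_mk]; ring
  rw [Complex.div_re, hN, ← add_div]
  congr 1
  simp only [Complex.neg_re, Complex.neg_im]
  ring
end

section
/- Assume (K²/4)((1+γ)² + q0²) − (δ + Kγ)² > 0 (condition (P2)), and suppose Δ(iβ₊, τ̄) = 0 for some τ̄ ≥ 0. Then the transversal quantity α'(τ̄) := Re(−Δ_τ/Δ_λ) evaluated at (iβ₊, τ̄) satisfies: α'(τ̄) > 0 if β₊ > 0 and α'(τ̄) < 0 if β₊ < 0. Similarly, if Δ(iβ₋, τ̄) = 0, then Re(−Δ_τ/Δ_λ) at (iβ₋, τ̄) satisfies: it is < 0 if β₋ > 0 and > 0 if β₋ < 0. -/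
theorem charEq_cross_aux (K δ γ ω0 q0 s β t : ℝ) (ha : 0 < δ + K * γ) (ht : 0 ≤ t)
    (hs : β = ω0 + K * q0 + s)
    (h : charEq K δ γ ω0 q0 (Complex.I * (β : ℂ)) t = 0) :
    ∃ D : ℝ, 0 < D ∧
      (-(deriv (fun t : ℝ => charEq K δ γ ω0 q0 (Complex.I * (β : ℂ)) t) t) /
        deriv (fun lam : ℂ => charEq K δ γ ω0 q0 lam t) (Complex.I * (β : ℂ))).re
        = β * s / D := by
  set a : ℝ := δ + K * γ with hadef
  set E : ℂ := Complex.exp (-(Complex.I * (β : ℂ)) * (t : ℂ)) with hE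
  set c : ℂ := ((K / 2 * (1 + γ) : ℝ) : ℂ) - Complex.I * ((K * q0 / 2 : ℝ) : ℂ) with hc
  have hroot : c * E = (a : ℂ) + Complex.I * (s : ℂ) := by
    have h' := h
    simp only [charEq] at h'
    rw [← hE, ← hadef] at h'
    have hs' : (β : ℂ) = ((ω0 + K * q0 : ℝ) : ℂ) + (s : ℂ) := by
      rw [hs]; push_cast; ring
    have : Complex.I * (β : ℂ) + a - c * E - Complex.I * ((ω0 + K * q0 : ℝ) : ℂ) = 0 := by
      rw [← h', hc]; ring
    linear_combination -this + Complex.I * hs'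
  have hform : ∀ lam : ℂ, ∀ u : ℝ, charEq K δ γ ω0 q0 lam u =
      lam + ((a : ℂ) - Complex.I * ((ω0 + K * q0 : ℝ) : ℂ))
        - c * Complex.exp (-lam * (u : ℂ)) := by
    intro lam u
    simp only [charEq, hc, hadef]; ring
  have hdt : deriv (fun t : ℝ => charEq K δ γ ω0 q0 (Complex.I * (β : ℂ)) t) t
      = Complex.I * β * ((a : ℂ) + Complex.I * (s : ℂ)) := by
    rw [← hroot]
    simp only [hform]
    have h1 : HasDerivAt (fun u : ℝ => (u : ℂ)) 1 t := Complex.ofRealCLM.hasDerivAt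
    have h2 := (((h1.const_mul (-(Complex.I * (β : ℂ)))).cexp).const_mul c).const_sub
      (Complex.I * (β : ℂ) + ((a : ℂ) - Complex.I * ((ω0 + K * q0 : ℝ) : ℂ)))
    rw [h2.deriv, ← hE]; ring
  have hdl : deriv (fun lam : ℂ => charEq K δ γ ω0 q0 lam t) (Complex.I * (β : ℂ))
      = 1 + t * ((a : ℂ) + Complex.I * (s : ℂ)) := by
    rw [← hroot]
    simp only [hform]
    have h1 := hasDerivAt_id (Complex.I * (β : ℂ))
    have h2 := (h1.add_const ((a : ℂ) - Complex.I * ((ω0 + K * q0 : ℝ) : ℂ))).sub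
      (((h1.neg.mul_const (t : ℂ)).cexp).const_mul c)
    refine h2.deriv.trans ?_
    simp only [Pi.neg_apply, id]
    rw [← hE]; ring
  rw [hdt, hdl]
  have hpos : 0 < (1 + t * a) ^ 2 + (t * s) ^ 2 := by positivity
  refine ⟨_, hpos, ?_⟩
  rw [Complex.div_re]
  simp [Complex.normSq_apply]
  rw [← add_div]
  congr 1 <;> ring

/-- Transversality at the crossing frequencies β₊ and β₋ under (P2):
the sign of α'(τ̄) = Re(−Δ_τ/Δ_λ) is the sign of β₊ at roots iβ₊, and the
opposite of the sign of β₋ at roots iβ₋. -/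
theorem stmt5 (K δ γ ω0 q0 : ℝ) (hK : 0 < K) (hδ : 0 < δ) (hγ : 0 ≤ γ)
    (hP2 : K ^ 2 / 4 * ((1 + γ) ^ 2 + q0 ^ 2) - (δ + K * γ) ^ 2 > 0) :
    (∀ τbar : ℝ, 0 ≤ τbar →
      charEq K δ γ ω0 q0 (Complex.I * (betaP K δ γ ω0 q0 : ℂ)) τbar = 0 →
      (0 < betaP K δ γ ω0 q0 →
        0 < (-(deriv (fun t : ℝ =>
              charEq K δ γ ω0 q0 (Complex.I * (betaP K δ γ ω0 q0 : ℂ)) t) τbar) /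
            deriv (fun lam : ℂ => charEq K δ γ ω0 q0 lam τbar)
              (Complex.I * (betaP K δ γ ω0 q0 : ℂ))).re) ∧
      (betaP K δ γ ω0 q0 < 0 →
        (-(deriv (fun t : ℝ =>
              charEq K δ γ ω0 q0 (Complex.I * (betaP K δ γ ω0 q0 : ℂ)) t) τbar) /
            deriv (fun lam : ℂ => charEq K δ γ ω0 q0 lam τbar)
              (Complex.I * (betaP K δ γ ω0 q0 : ℂ))).re < 0)) ∧
    (∀ τbar : ℝ, 0 ≤ τbar →
      charEq K δ γ ω0 q0 (Complex.I * (betaM K δ γ ω0 q0 : ℂ)) τbar = 0 →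
      (0 < betaM K δ γ ω0 q0 →
        (-(deriv (fun t : ℝ =>
              charEq K δ γ ω0 q0 (Complex.I * (betaM K δ γ ω0 q0 : ℂ)) t) τbar) /
            deriv (fun lam : ℂ => charEq K δ γ ω0 q0 lam τbar)
              (Complex.I * (betaM K δ γ ω0 q0 : ℂ))).re < 0) ∧
      (betaM K δ γ ω0 q0 < 0 →
        0 < (-(deriv (fun t : ℝ =>
              charEq K δ γ ω0 q0 (Complex.I * (betaM K δ γ ω0 q0 : ℂ)) t) τbar) /
            deriv (fun lam : ℂ => charEq K δ γ ω0 q0 lam τbar)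
              (Complex.I * (betaM K δ γ ω0 q0 : ℂ))).re)) := by
  have ha : 0 < δ + K * γ := by positivity
  have hs := Real.sqrt_pos.mpr hP2
  refine ⟨fun t ht h => ?_, fun t ht h => ?_⟩
  · obtain ⟨D, hD, e⟩ := charEq_cross_aux K δ γ ω0 q0 _ (betaP K δ γ ω0 q0) t ha ht rfl h
    rw [e]
    exact ⟨fun hb => div_pos (mul_pos hb hs) hD,
      fun hb => div_neg_of_neg_of_pos (mul_neg_of_neg_of_pos hb hs) hD⟩
  · obtain ⟨D, hD, e⟩ := charEq_cross_aux K δ γ ω0 q0 _ (betaM K δ γ ω0 q0) t ha ht (sub_eq_add_neg _ _) h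
    rw [e]
    exact ⟨fun hb => div_neg_of_neg_of_pos (mul_neg_of_pos_of_neg hb (neg_lt_zero.mpr hs)) hD,
      fun hb => div_pos (mul_pos_of_neg_of_neg hb (neg_lt_zero.mpr hs)) hD⟩
end

section
/- (Theorem 1(1)(a).) Assume K(1−γ)/2 < δ and (δ + Kγ)² − (K²/4)((1+γ)² + q0²) > 0 (condition (P1)). Then for every τ ≥ 0, every complex root λ of the characteristic equation Δ(λ,τ) = 0 has negative real part. -/
/-- Theorem 1(1)(a): under K(1−γ)/2 < δ and (P1), all characteristic roots
have negative real part for every delay τ ≥ 0. -/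
theorem stmt8 (K δ γ ω0 q0 : ℝ) (hK : 0 < K) (hδ : 0 < δ) (hγ : 0 ≤ γ)
    (hstab0 : K * (1 - γ) / 2 < δ)
    (hP1 : (δ + K * γ) ^ 2 - K ^ 2 / 4 * ((1 + γ) ^ 2 + q0 ^ 2) > 0) :
    ∀ τ : ℝ, 0 ≤ τ → ∀ lam : ℂ, charEq K δ γ ω0 q0 lam τ = 0 → lam.re < 0 := by
  intro τ hτ lam h
  by_contra hneg
  have hx : 0 ≤ lam.re := not_lt.mp hneg
  have ha : 0 < δ + K * γ := by positivity
  have heq : lam + ((δ + K * γ : ℝ) : ℂ) - Complex.I * ((ω0 + K * q0 : ℝ) : ℂ)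
      = (((K / 2 * (1 + γ) : ℝ) : ℂ) - Complex.I * ((K * q0 / 2 : ℝ) : ℂ))
        * Complex.exp (-lam * (τ : ℂ)) := by
    unfold charEq at h
    linear_combination h
  have hn := congrArg Complex.normSq heq
  rw [Complex.normSq_mul] at hn
  have he : Complex.normSq (Complex.exp (-lam * (τ : ℂ))) ≤ 1 := by
    rw [Complex.normSq_eq_norm_sq, Complex.norm_exp]
    have h1 : (-lam * (τ : ℂ)).re ≤ 0 := by
      simp only [Complex.mul_re, Complex.neg_re, Complex.ofReal_re, Complex.ofReal_im]
      nlinarith [mul_nonneg hx hτ]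
    exact pow_le_one₀ (Real.exp_nonneg _) (Real.exp_le_one_iff.mpr h1)
  have hL : Complex.normSq (lam + ((δ + K * γ : ℝ) : ℂ) - Complex.I * ((ω0 + K * q0 : ℝ) : ℂ))
      = (lam.re + (δ + K * γ)) ^ 2 + (lam.im - (ω0 + K * q0)) ^ 2 := by
    rw [Complex.normSq_apply]
    simp only [Complex.sub_re, Complex.add_re, Complex.mul_re, Complex.sub_im, Complex.add_im,
      Complex.mul_im, Complex.ofReal_re, Complex.ofReal_im, Complex.I_re, Complex.I_im]
    ring
  have hR : Complex.normSq (((K / 2 * (1 + γ) : ℝ) : ℂ) - Complex.I * ((K * q0 / 2 : ℝ) : ℂ))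
      = K ^ 2 / 4 * ((1 + γ) ^ 2 + q0 ^ 2) := by
    rw [Complex.normSq_apply]
    simp only [Complex.sub_re, Complex.mul_re, Complex.sub_im,
      Complex.mul_im, Complex.ofReal_re, Complex.ofReal_im, Complex.I_re, Complex.I_im]
    ring
  rw [hL, hR] at hn
  have hC : 0 ≤ K ^ 2 / 4 * ((1 + γ) ^ 2 + q0 ^ 2) := by positivity
  have h2 := mul_le_mul_of_nonneg_left he hC
  have h3 := mul_nonneg hx ha.le
  nlinarith [sq_nonneg lam.re, sq_nonneg (lam.im - (ω0 + K * q0))]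
end

section
/- Assume K(1−γ)/2 > δ. Let τ ≥ 0 and suppose that for every τ' ∈ [0, τ] the equation Δ(λ, τ') = 0 has no purely imaginary root λ = iβ with β real. Then Δ(·, τ) has at least one root with positive real part; in particular, for delays smaller than the first purely-imaginary crossing value τ0, the incoherent state is unstable. -/
theorem charEq_aux (K δ γ ω0 q0 : ℝ) (lam : ℂ) (τ : ℝ) :
    charEq K δ γ ω0 q0 lam τ = lam + (((δ + K * γ : ℝ) : ℂ) - Complex.I * ((ω0 + K * q0 : ℝ) : ℂ))
      - (((K / 2 * (1 + γ) : ℝ) : ℂ) - Complex.I * ((K * q0 / 2 : ℝ) : ℂ))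
        * Complex.exp (-lam * (τ : ℂ)) := by
  unfold charEq
  ring

theorem open_aux (a b : ℂ) (l : ℂ) (t : ℝ) (ha : 0 < a.re) (hl : 0 < l.re) (ht : 0 ≤ t)
    (h0 : l + a - b * Complex.exp (-l * (t : ℂ)) = 0) :
    ∀ᶠ t' : ℝ in nhds t, ∃ l' : ℂ, l' + a - b * Complex.exp (-l' * (t' : ℂ)) = 0 ∧ 0 < l'.re := by
  have h1 : HasStrictFDerivAt (fun p : ℂ × ℝ => p.1) (ContinuousLinearMap.fst ℝ ℂ ℝ) (l, t) :=
    hasStrictFDerivAt_fst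
  have h2 : HasStrictFDerivAt (fun p : ℂ × ℝ => p.2) (ContinuousLinearMap.snd ℝ ℂ ℝ) (l, t) :=
    hasStrictFDerivAt_snd
  have h3 : HasStrictFDerivAt (fun p : ℂ × ℝ => (p.2 : ℂ))
      (Complex.ofRealCLM.comp (ContinuousLinearMap.snd ℝ ℂ ℝ)) (l, t) :=
    Complex.ofRealCLM.hasStrictFDerivAt.comp (l, t) h2
  have h4 := (h1.add_const a).sub (((h1.neg.mul h3).cexp).const_mul b)
  have h5 := h4.prodMk h2
  have h6 := h5.map_nhds_eq_of_surj (by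
    rw [LinearMap.range_eq_top]
    rintro ⟨w, k⟩
    have hD : (1 + t * (l + a) : ℂ) ≠ 0 := by
      intro h
      have := congrArg Complex.re h
      simp at this
      nlinarith [mul_nonneg ht (add_pos hl ha).le]
    have hb : b * Complex.exp (-l * (t : ℂ)) = l + a := by linear_combination -h0
    refine ⟨((w - (l + a) * l * k) / (1 + t * (l + a)), k), ?_⟩
    ext1
    · simp
      have e : b * (Complex.exp (-(l * (t : ℂ)))) = l + a := by rw [← hb]; ring_nf
      have hD' : (1 + (l + a) * t : ℂ) ≠ 0 := by rwa [mul_comm (l + a)]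
      field_simp
      rw [e]
      ring
    · simp)
  have h7 : {p : ℂ × ℝ | 0 < p.1.re} ∈ nhds (l, t) :=
    (isOpen_lt continuous_const (Complex.continuous_re.comp continuous_fst)).mem_nhds hl
  have h8 := Filter.image_mem_map (m := fun p : ℂ × ℝ =>
    (p.1 + a - b * Complex.exp (-p.1 * (p.2 : ℂ)), p.2)) h7
  have h9 := h6.le
  have h10 := (h6.symm.le : _ ≤ _) h8
  simp only [Pi.mul_apply, Pi.neg_apply] at h10
  have hc : Filter.Tendsto (fun t' : ℝ => ((0 : ℂ), t')) (nhds t)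
      (nhds (l + a - b * Complex.exp (-l * (t : ℂ)), t)) := by
    rw [h0]
    exact (by fun_prop : Continuous fun t' : ℝ => ((0 : ℂ), t')).tendsto t
  filter_upwards [hc h10] with t' ht'
  obtain ⟨⟨l', s⟩, hp, he⟩ := ht'
  simp only [Prod.mk.injEq] at he
  obtain ⟨he1, rfl⟩ := he
  exact ⟨l', he1, hp⟩

/-- If K(1−γ)/2 > δ and no purely imaginary root occurs for any delay in
[0, τ], then the characteristic equation at delay τ has a root with positive
real part (the incoherent state is unstable before the first crossing). -/
theorem stmt10 (K δ γ ω0 q0 : ℝ) (hK : 0 < K) (hδ : 0 < δ) (hγ : 0 ≤ γ)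
    (hunst0 : δ < K * (1 - γ) / 2)
    (τ : ℝ) (hτ : 0 ≤ τ)
    (hnocross : ∀ τ' : ℝ, τ' ∈ Set.Icc 0 τ →
      ∀ β : ℝ, charEq K δ γ ω0 q0 (Complex.I * (β : ℂ)) τ' ≠ 0) :
    ∃ lam : ℂ, charEq K δ γ ω0 q0 lam τ = 0 ∧ 0 < lam.re := by
  simp only [charEq_aux] at hnocross ⊢
  set a : ℂ := ((δ + K * γ : ℝ) : ℂ) - Complex.I * ((ω0 + K * q0 : ℝ) : ℂ) with ha
  set b : ℂ := ((K / 2 * (1 + γ) : ℝ) : ℂ) - Complex.I * ((K * q0 / 2 : ℝ) : ℂ) with hb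
  have hare : a.re = δ + K * γ := by simp [ha]
  have hbre : b.re = K / 2 * (1 + γ) := by simp [hb]
  have hapos : 0 < a.re := by rw [hare]; positivity
  let S : Set ℝ := {t | ∃ l : ℂ, l + a - b * Complex.exp (-l * (t : ℂ)) = 0 ∧ 0 < l.re}
  have hclosed : IsClosed (S ∩ Set.Icc 0 τ) := by
    have hcomp : IsCompact ((Metric.closedBall (0 : ℂ) (‖a‖ + ‖b‖) ×ˢ Set.Icc 0 τ) ∩
        ({p : ℂ × ℝ | 0 ≤ p.1.re} ∩
          {p : ℂ × ℝ | p.1 + a - b * Complex.exp (-p.1 * (p.2 : ℂ)) = 0})) := by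
      refine ((isCompact_closedBall _ _).prod isCompact_Icc).inter_right (IsClosed.inter ?_ ?_)
      · exact isClosed_le continuous_const (Complex.continuous_re.comp continuous_fst)
      · exact isClosed_eq (by fun_prop) continuous_const
    have himg := (hcomp.image continuous_snd).isClosed
    convert himg using 1
    ext t
    constructor
    · rintro ⟨⟨l, h, hl⟩, ht⟩
      refine ⟨(l, t), ⟨⟨?_, ht⟩, hl.le, h⟩, rfl⟩
      have e : l = b * Complex.exp (-l * (t : ℂ)) - a := by linear_combination h
      have hn : ‖Complex.exp (-l * (t : ℂ))‖ ≤ 1 := by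
        rw [Complex.norm_exp]
        simp
        exact mul_nonneg hl.le ht.1
      simp only [mem_closedBall_zero_iff]
      calc ‖l‖ = ‖b * Complex.exp (-l * (t : ℂ)) - a‖ := by rw [← e]
        _ ≤ ‖b * Complex.exp (-l * (t : ℂ))‖ + ‖a‖ := norm_sub_le _ _
        _ ≤ ‖a‖ + ‖b‖ := by
          rw [norm_mul]
          nlinarith [norm_nonneg b]
    · rintro ⟨⟨l, s⟩, ⟨⟨_, hs⟩, hl, h⟩, rfl⟩
      refine ⟨⟨l, h, lt_of_le_of_ne hl ?_⟩, hs⟩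
      intro h0
      refine hnocross s hs l.im ?_
      have : Complex.I * (l.im : ℂ) = l := by
        apply Complex.ext <;> simp
        exact h0
      rw [this]
      exact h
  have h0S : (0 : ℝ) ∈ S := by
    refine ⟨b - a, by simp, ?_⟩
    rw [Complex.sub_re, hare, hbre]
    linarith
  have hsub := hclosed.Icc_subset_of_forall_mem_nhdsWithin h0S (by
    rintro t ⟨⟨l, h, hl⟩, ht⟩
    exact mem_nhdsWithin_of_mem_nhds (open_aux a b l t hapos hl ht.1 h))
  exact hsub ⟨hτ, le_rfl⟩
end

section
/- Assume (K²/4)((1+γ)² + q0²) − (δ + Kγ)² > 0 (condition (P2)) and (δ + Kγ)² + (ω0 + Kq0)² − (K²/4)((1+γ)² + q0²) > 0 (condition (P4)). Then there are only finitely many stability switches: there exists τ* > 0 such that for every τ > τ*, the equation Δ(λ,τ) = 0 has at least one root λ with positive real part. -/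
lemma lip_log (b : ℝ) (hb : 0 < b) (w z : ℂ) (hw : 0 ≤ w.re) (hz : 0 ≤ z.re) :
    ‖Complex.log (1 + w / b) - Complex.log (1 + z / b)‖ ≤ 1 / b * ‖w - z‖ := by
  have key : ∀ x ∈ {x : ℂ | 0 ≤ x.re}, 1 ≤ (1 + x / (b : ℂ)).re := by
    intro x hx
    simp only [Complex.add_re, Complex.one_re, Complex.div_ofReal_re]
    have : 0 ≤ x.re / b := div_nonneg hx hb.le
    linarith
  refine Convex.norm_image_sub_le_of_norm_hasDerivWithin_le
    (f := fun x : ℂ => Complex.log (1 + x / b))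
    (f' := fun x : ℂ => (1 / (b : ℂ)) / (1 + x / b)) (s := {x : ℂ | 0 ≤ x.re})
    ?_ ?_ (convex_halfSpace_re_ge 0) hz hw
  · intro x hx
    have h1 : HasDerivAt (fun x : ℂ => 1 + x / (b : ℂ)) (1 / (b : ℂ)) x :=
      ((hasDerivAt_id x).div_const (b : ℂ)).const_add 1
    refine (h1.clog ?_).hasDerivWithinAt
    exact Or.inl (lt_of_lt_of_le one_pos (key x hx))
  · intro x hx
    have h1 : 1 ≤ ‖1 + x / (b : ℂ)‖ :=
      (key x hx).trans ((le_abs_self _).trans (Complex.abs_re_le_norm _))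
    rw [norm_div, norm_div, norm_one, Complex.norm_real, Real.norm_of_nonneg hb.le]
    exact div_le_self (by positivity) h1

lemma fixed_pt (b r : ℝ) (w0 : ℂ) (hr : 0 < r) (h0 : w0.re = 2 * r)
    (hM : ‖w0‖ + r ≤ r * b) :
    ∃ w : ℂ, 0 < w.re ∧ w = w0 - Complex.log (1 + w / b) := by
  have hn : 2 * r ≤ ‖w0‖ := h0 ▸ (le_abs_self _).trans (Complex.abs_re_le_norm _)
  have hb3 : 3 ≤ b := by
    by_contra h
    push Not at h
    nlinarith
  have hb : 0 < b := by linarith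
  have hre : ∀ w ∈ Metric.closedBall w0 r, r ≤ w.re := by
    intro w hw
    rw [Metric.mem_closedBall, dist_eq_norm] at hw
    have := (neg_abs_le (w - w0).re)
    have h2 := Complex.abs_re_le_norm (w - w0)
    rw [Complex.sub_re] at this h2
    linarith
  have hmaps : Set.MapsTo (fun w : ℂ => w0 - Complex.log (1 + w / b))
      (Metric.closedBall w0 r) (Metric.closedBall w0 r) := by
    intro w hw
    have h1 := lip_log b hb w 0 (hr.le.trans (hre w hw)) le_rfl
    rw [Metric.mem_closedBall, dist_eq_norm] at hw ⊢
    simp only [zero_div, add_zero, Complex.log_one, sub_zero] at h1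
    have h2 : ‖w‖ ≤ ‖w0‖ + r := by
      have := norm_le_norm_add_norm_sub w0 w
      rw [norm_sub_rev] at this
      linarith
    have h3 : 1 / b * ‖w‖ ≤ r := by
      rw [one_div_mul_eq_div, div_le_iff₀ hb]; linarith
    have h4 : w0 - Complex.log (1 + w / b) - w0 = -Complex.log (1 + w / b) := by ring
    rw [h4, norm_neg]
    linarith
  have hc : ContractingWith (1 / 3 : NNReal) (hmaps.restrict _ _ _) := by
    refine ⟨?_, LipschitzWith.of_dist_le_mul ?_⟩
    · rw [← NNReal.coe_lt_coe]; norm_num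
    · rintro ⟨x, hx⟩ ⟨y, hy⟩
      rw [Subtype.dist_eq, Subtype.dist_eq]
      simp only [Set.MapsTo.val_restrict_apply, dist_eq_norm]
      have h1 := lip_log b hb y x (hr.le.trans (hre y hy)) (hr.le.trans (hre x hx))
      have h4 : w0 - Complex.log (1 + x / b) - (w0 - Complex.log (1 + y / b))
        = Complex.log (1 + y / b) - Complex.log (1 + x / b) := by ring
      rw [h4, norm_sub_rev x y]
      refine h1.trans (mul_le_mul_of_nonneg_right ?_ (norm_nonneg _))
      have := one_div_le_one_div_of_le (by norm_num : (0:ℝ) < 3) hb3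
      simpa using this
  obtain ⟨w, hw, hfix, -⟩ := ContractingWith.exists_fixedPoint'
    (Metric.isClosed_closedBall (x := w0) (ε := r)).isComplete hmaps hc
    (Metric.mem_closedBall_self hr.le) (edist_ne_top _ _)
  exact ⟨w, hr.trans_le (hre w hw), hfix.symm⟩

/-- Under (P2) and (P4) there are only finitely many stability switches:
beyond some delay τ* every characteristic equation has a root with positive
real part. -/
theorem stmt12 (K δ γ ω0 q0 : ℝ) (hK : 0 < K) (hδ : 0 < δ) (hγ : 0 ≤ γ)
    (hP2 : K ^ 2 / 4 * ((1 + γ) ^ 2 + q0 ^ 2) - (δ + K * γ) ^ 2 > 0)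
    (hP4 : (δ + K * γ) ^ 2 + (ω0 + K * q0) ^ 2
        - K ^ 2 / 4 * ((1 + γ) ^ 2 + q0 ^ 2) > 0) :
    ∃ τstar : ℝ, 0 < τstar ∧ ∀ τ : ℝ, τstar < τ →
      ∃ lam : ℂ, charEq K δ γ ω0 q0 lam τ = 0 ∧ 0 < lam.re := by
  set a := δ + K * γ with ha_def
  set Ω := ω0 + K * q0 with hΩ
  have ha : 0 < a := by positivity
  obtain ⟨c, hc⟩ : ∃ c : ℂ, c = ((K / 2 * (1 + γ) : ℝ) : ℂ)
    - Complex.I * ((K * q0 / 2 : ℝ) : ℂ) := ⟨_, rfl⟩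
  have hcn : ‖c‖ ^ 2 = K ^ 2 / 4 * ((1 + γ) ^ 2 + q0 ^ 2) := by
    rw [← Complex.normSq_eq_norm_sq, Complex.normSq_apply]
    have h1 : c.re = K / 2 * (1 + γ) := by
      rw [hc, Complex.sub_re, Complex.re_mul_ofReal]; simp
    have h2 : c.im = - (K * q0 / 2) := by
      rw [hc, Complex.sub_im, Complex.im_mul_ofReal]; simp
    rw [h1, h2]; ring
  have hca : a < ‖c‖ := by
    refine lt_of_pow_lt_pow_left₀ 2 (norm_nonneg _) ?_
    rw [hcn]; linarith
  obtain ⟨r, hr⟩ : ∃ r, r = Real.log (‖c‖ / a) / 2 := ⟨_, rfl⟩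
  have hrpos : 0 < r := by
    have := Real.log_pos ((one_lt_div ha).2 hca)
    rw [hr]; linarith
  have hpi := Real.pi_pos
  refine ⟨(3 * r + Real.pi) / (r * a), by positivity, fun τ hτ => ?_⟩
  have hτ0 : 0 < τ := lt_trans (by positivity) hτ
  rw [div_lt_iff₀ (by positivity)] at hτ
  obtain ⟨c', hc'⟩ : ∃ c', c' = c * Complex.exp (-((Ω * τ : ℝ) : ℂ) * Complex.I) := ⟨_, rfl⟩
  have hc'n : ‖c'‖ = ‖c‖ := by
    rw [hc', norm_mul, ← Complex.ofReal_neg, Complex.norm_exp_ofReal_mul_I, mul_one]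
  have haC : (a : ℂ) ≠ 0 := by exact_mod_cast ha.ne'
  have hτC : (τ : ℂ) ≠ 0 := by exact_mod_cast hτ0.ne'
  have hc'0 : c' ≠ 0 := by
    rw [← norm_pos_iff, hc'n]; linarith
  have hre : (Complex.log (c' / a)).re = 2 * r := by
    rw [Complex.log_re, norm_div, hc'n, Complex.norm_real, Real.norm_of_nonneg ha.le, hr]
    ring
  have hnorm : ‖Complex.log (c' / a)‖ ≤ 2 * r + Real.pi := by
    have h1 := Complex.norm_le_abs_re_add_abs_im (Complex.log (c' / a))
    have h2 : |(Complex.log (c' / a)).im| ≤ Real.pi := by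
      rw [Complex.log_im]; exact Complex.abs_arg_le_pi _
    rw [hre, abs_of_pos (by positivity)] at h1
    linarith
  obtain ⟨w, hwre, hw⟩ := fixed_pt (a * τ) r (Complex.log (c' / a)) hrpos hre (by nlinarith)
  have hne : 1 + w / ((a * τ : ℝ) : ℂ) ≠ 0 := by
    intro h
    have h1 := congrArg Complex.re h
    simp only [Complex.add_re, Complex.one_re, Complex.div_ofReal_re, Complex.zero_re] at h1
    have : 0 < w.re / (a * τ) := by positivity
    linarith
  have hexp : Complex.exp w = c' / a / (1 + w / ((a * τ : ℝ) : ℂ)) := by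
    conv_lhs => rw [hw]
    rw [Complex.exp_sub, Complex.exp_log hne, Complex.exp_log (div_ne_zero hc'0 haC)]
  have hexp2 : (a + w / τ) * Complex.exp w = c' := by
    rw [eq_div_iff hne] at hexp
    have h5 : (a + w / τ : ℂ) = a * (1 + w / ((a * τ : ℝ) : ℂ)) := by
      push_cast; field_simp
    rw [h5, mul_assoc, mul_comm _ (Complex.exp w), hexp]
    field_simp
  have hfin : (a + w / τ : ℂ) = c' * Complex.exp (-w) := by
    rw [← hexp2, mul_assoc, ← Complex.exp_add]; simp
  refine ⟨Complex.I * Ω + w / τ, ?_, ?_⟩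
  · have he : Complex.exp (-(Complex.I * Ω + w / τ) * τ)
        = Complex.exp (-((Ω * τ : ℝ) : ℂ) * Complex.I) * Complex.exp (-w) := by
      rw [← Complex.exp_add]; congr 1; push_cast; field_simp; ring
    unfold charEq
    rw [he]
    rw [hc', hc] at hfin
    linear_combination hfin
  · rw [Complex.add_re, Complex.re_mul_ofReal, Complex.div_ofReal_re]
    simp only [Complex.I_re, zero_mul, zero_add]
    positivity
end
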